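/- arXiv:1806.07786 — 2 statements merged into one kernel-verified Lean document; each statement's English description precedes it below -/
import Mathlib

section
/- Let p be a prime number and let Γ be a vertex transitive simple graph on p vertices with at least one edge. Then Γ is non-singular, i.e. 0 is not an eigenvalue of the adjacency matrix of Γ. -/
open scoped Classical in
/-- Over `ZMod p`, the adjacency matrix raised to the `p`-th power is a nonzero scalar. -/
theorem det_aux {V : Type*} [Fintype V] [DecidableEq V] (Γ : SimpleGraph V)
    (p : ℕ) [hp : Fact p.Prime] (hcard : Fintype.card V = p)
    (htrans : ∀ u v : V, ∃ e : Γ ≃g Γ, e u = v)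
    (hedge : ∃ u v : V, Γ.Adj u v) : (Γ.adjMatrix (ZMod p)).det ≠ 0 := by
  obtain ⟨v0, w0, hvw⟩ := hedge
  have hp' := hp.out
  have hfin : Finite (Γ ≃g Γ) :=
    Finite.of_injective (fun e : Γ ≃g Γ => (e.toEquiv : Equiv.Perm V))
      (fun a b h => RelIso.toEquiv_injective h)
  let act : MulAction (Γ ≃g Γ) V :=
    { smul := fun e v => e v
      one_smul := fun _ => rfl
      mul_smul := fun _ _ _ => rfl }
  have horb : MulAction.orbit (Γ ≃g Γ) v0 = Set.univ := by
    ext v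
    obtain ⟨e, he⟩ := htrans v0 v
    simp only [Set.mem_univ, iff_true]
    exact ⟨e, he⟩
  have hdvd : p ∣ Nat.card (Γ ≃g Γ) := by
    have h := MulAction.index_stabilizer (Γ ≃g Γ) v0
    rw [horb, Set.ncard_univ, Nat.card_eq_fintype_card, hcard] at h
    rw [← h]
    exact Subgroup.index_dvd_card _
  obtain ⟨g, hg⟩ := exists_prime_orderOf_dvd_card' p hdvd
  let φ : (Γ ≃g Γ) →* Equiv.Perm V :=
    { toFun := fun e => e.toEquiv, map_one' := rfl, map_mul' := fun _ _ => rfl }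
  have hφ : Function.Injective φ := fun a b h => RelIso.toEquiv_injective h
  set σ : Equiv.Perm V := φ g with hσ
  have hσo : orderOf σ = p := by rw [hσ, orderOf_injective φ hφ, hg]
  have hcyc : σ.IsCycle :=
    Equiv.Perm.isCycle_of_prime_order'' (by rw [hcard]; exact hp') (by rw [hσo, hcard])
  have hsupp : σ.support = Finset.univ := by
    rw [← Finset.card_eq_iff_eq_univ, ← hcyc.orderOf, hσo, hcard]
  have hne : ∀ v, σ v ≠ v := fun v => by
    rw [← Equiv.Perm.mem_support, hsupp]; exact Finset.mem_univ v
  have hσp : σ ^ p = 1 := by rw [← hσo]; exact pow_orderOf_eq_one σ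
  have hadj : ∀ (i : ℕ) (u v : V), Γ.Adj ((σ ^ i) u) ((σ ^ i) v) ↔ Γ.Adj u v := by
    intro i u v
    rw [hσ, ← map_pow]
    exact (g ^ i).map_rel_iff
  -- every vertex is reached by a power
  have hreach : ∀ u v : V, ∃ i ∈ Finset.range p, (σ ^ i) u = v := by
    intro u v
    obtain ⟨i, hi, h⟩ := (hcyc.sameCycle (hne u) (hne v)).exists_pow_eq'
    exact ⟨i, Finset.mem_range.2 (lt_of_lt_of_le hi hσo.le), h⟩
  have himg : ∀ u : V, (Finset.range p).image (fun i => (σ ^ i) u) = Finset.univ := by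
    intro u
    ext v
    simpa using hreach u v
  have hinj : ∀ u : V, Set.InjOn (fun i : ℕ => (σ ^ i) u) (Finset.range p : Set ℕ) := by
    intro u
    apply Finset.card_image_iff.1
    rw [himg, Finset.card_univ, hcard, Finset.card_range]
  have hsum : ∀ (u : V) (f : V → ZMod p),
      ∑ v, f v = ∑ i ∈ Finset.range p, f ((σ ^ i) u) := by
    intro u f
    rw [← himg u, Finset.sum_image (hinj u)]
  set S := (Finset.range p).filter (fun i => Γ.Adj v0 ((σ ^ i) v0)) with hS
  have hSadj : ∀ (u : V) (i : ℕ), Γ.Adj u ((σ ^ i) u) ↔ Γ.Adj v0 ((σ ^ i) v0) := by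
    intro u i
    obtain ⟨j, -, rfl⟩ := hreach v0 u
    rw [← Equiv.Perm.mul_apply, ← pow_add, add_comm, pow_add, Equiv.Perm.mul_apply, hadj]
  have hSpos : 0 < S.card := by
    obtain ⟨i, hi, h⟩ := hreach v0 w0
    exact Finset.card_pos.2 ⟨i, Finset.mem_filter.2 ⟨hi, by rw [h]; exact hvw⟩⟩
  have hSlt : S.card < p := by
    have : S ⊂ Finset.range p := by
      apply Finset.filter_ssubset.2
      exact ⟨0, Finset.mem_range.2 hp'.pos, by simp⟩
    simpa using Finset.card_lt_card this
  have hk : (S.card : ZMod p) ≠ 0 := by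
    rw [Ne, ZMod.natCast_eq_zero_iff]
    exact Nat.not_dvd_of_pos_of_lt hSpos hSlt
  let T : Module.End (ZMod p) (V → ZMod p) := LinearMap.funLeft (ZMod p) (ZMod p) σ
  have hT : ∀ (i : ℕ) (f : V → ZMod p) (u : V), (T ^ i) f u = f ((σ ^ i) u) := by
    intro i
    induction i with
    | zero => intro f u; simp
    | succ n ih =>
      intro f u
      rw [pow_succ, Module.End.mul_apply, ih, pow_succ' σ, Equiv.Perm.mul_apply]
      rfl
  have hTp : T ^ p = 1 := by
    refine LinearMap.ext fun f => funext fun u => ?_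
    rw [hT, hσp]
    rfl
  let q : Polynomial (ZMod p) := ∑ i ∈ S, Polynomial.X ^ i
  have hq : Polynomial.aeval T q = (Γ.adjMatrix (ZMod p)).mulVecLin := by
    refine LinearMap.ext fun f => funext fun u => ?_
    simp only [q, map_sum, map_pow, Polynomial.aeval_X, LinearMap.sum_apply, Finset.sum_apply, hT,
      Matrix.mulVecLin_apply, Matrix.mulVec, dotProduct, SimpleGraph.adjMatrix_apply]
    rw [hsum u, hS, Finset.sum_filter]
    refine Finset.sum_congr rfl fun i _ => ?_
    simp [hSadj]
  have hqp : (Polynomial.aeval T q) ^ p = (S.card : Module.End (ZMod p) (V → ZMod p)) := by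
    rw [← map_pow]
    simp only [q]
    rw [sum_pow_char]
    simp only [map_sum, map_pow, Polynomial.aeval_X]
    rw [Finset.sum_congr rfl (fun i _ => by rw [← pow_mul, mul_comm, pow_mul, hTp, one_pow])]
    simp
  intro hdet
  obtain ⟨x, hx, h0⟩ := Matrix.exists_mulVec_eq_zero_iff.2 hdet
  apply hx
  have h1 : ((Polynomial.aeval T q) ^ p) x = 0 := by
    obtain ⟨m, rfl⟩ : ∃ m, p = m + 1 := ⟨p - 1, by have := hp'.pos; omega⟩
    rw [pow_succ, Module.End.mul_apply, hq, Matrix.mulVecLin_apply, h0, map_zero]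
  rw [hqp, Module.End.natCast_apply, ← Nat.cast_smul_eq_nsmul (ZMod p)] at h1
  exact (smul_eq_zero.1 h1).resolve_left hk

open scoped Classical in
/-- A vertex transitive simple graph on a prime number of vertices with at least one edge
is non-singular: `0` is not an eigenvalue of its adjacency matrix. -/
theorem stmt18 {V : Type*} [Fintype V] [DecidableEq V] (Γ : SimpleGraph V)
    (p : ℕ) (hp : p.Prime) (hcard : Fintype.card V = p)
    (htrans : ∀ u v : V, ∃ e : Γ ≃g Γ, e u = v)
    (hedge : ∃ u v : V, Γ.Adj u v) :
    ¬ ∃ x : V → ℂ, x ≠ 0 ∧ (Γ.adjMatrix ℂ).mulVec x = 0 := by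
  rw [Matrix.exists_mulVec_eq_zero_iff]
  have := Fact.mk hp
  have h := det_aux Γ p hcard htrans hedge
  have key : ∀ (R : Type) [CommRing R],
      (Γ.adjMatrix R).det = (((Γ.adjMatrix ℤ).det : ℤ) : R) := by
    intro R _
    have : Γ.adjMatrix R = (Int.castRingHom R).mapMatrix (Γ.adjMatrix ℤ) := by
      ext i j
      simp [SimpleGraph.adjMatrix_apply]
    rw [this, ← RingHom.map_det]
    rfl
  rw [key] at h ⊢
  intro h0
  rw [Int.cast_eq_zero] at h0
  exact h (by rw [h0, Int.cast_zero])
end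

section
/- Let Γ be a finite simple graph with vertex set V and adjacency map α, and let G be a group of automorphisms of Γ acting transitively on V. Define τ : G → ℂ by τ(g) = tr(g∘α), the trace of the composition of the permutation action of g on ℂV with α (equivalently, τ(g) is the number of vertices v with v adjacent to v^g). Then: (a) τ is a class function on G; and (b) if the permutation character of G on V is multiplicity-free (each irreducible character of G occurs in it with multiplicity at most 1), then every eigenvalue of the adjacency matrix of Γ equals ⟨τ, χ⟩ = (1/|G|) Σ_{g ∈ G} τ(g) · conj(χ(g)) for some irreducible complex character χ of G. -/
/-- A representation `ρ` of `G` on a complex vector space `W` is irreducible if `W` is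
nontrivial and the only `G`-invariant subspaces are `⊥` and `⊤`. -/
def IsIrredRep {G W : Type*} [Group G] [AddCommGroup W] [Module ℂ W]
    (ρ : Representation ℂ G W) : Prop :=
  Nontrivial W ∧
    ∀ p : Submodule ℂ W, (∀ (g : G), ∀ w ∈ p, ρ g w ∈ p) → p = ⊥ ∨ p = ⊤

open Module in
theorem aux_trace_comp {E W : Type*} [AddCommGroup E] [Module ℂ E] [FiniteDimensional ℂ E]
    [AddCommGroup W] [Module ℂ W] [FiniteDimensional ℂ W]
    (a : E →ₗ[ℂ] E) (b : W →ₗ[ℂ] W) (T : (W →ₗ[ℂ] E) →ₗ[ℂ] (W →ₗ[ℂ] E))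
    (hT : ∀ f, T f = a ∘ₗ f ∘ₗ b) :
    LinearMap.trace ℂ _ T = LinearMap.trace ℂ _ a * LinearMap.trace ℂ _ b := by
  have h : T = (dualTensorHomEquiv ℂ W E).conj
      (TensorProduct.map (Module.Dual.transpose (R := ℂ) b) a) := by
    rw [LinearEquiv.conj_apply]
    rw [LinearEquiv.eq_comp_toLinearMap_symm]
    ext f e w
    simp [hT, Module.Dual.transpose_apply]
  rw [h, LinearMap.trace_conj', LinearMap.trace_tensorProduct', LinearMap.trace_transpose', mul_comm]

open Module in
theorem aux_main {G E W : Type*} [Group G] [Fintype G]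
    [AddCommGroup E] [Module ℂ E] [FiniteDimensional ℂ E]
    [AddCommGroup W] [Module ℂ W] [FiniteDimensional ℂ W]
    (σ : Representation ℂ G E) (ρ : Representation ℂ G W) (A : E →ₗ[ℂ] E)
    (hA : ∀ g, σ g ∘ₗ A = A ∘ₗ σ g) (i : W →ₗ[ℂ] E) (hi : i ≠ 0)
    (hint : ∀ g, σ g ∘ₗ i = i ∘ₗ ρ g) (μ : ℂ) (hμ : A ∘ₗ i = μ • i)
    (hm : (∑ g : G, LinearMap.trace ℂ E (σ g) * LinearMap.trace ℂ W (ρ g⁻¹)) = 0 ∨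
      (∑ g : G, LinearMap.trace ℂ E (σ g) * LinearMap.trace ℂ W (ρ g⁻¹)) = Fintype.card G) :
    ∑ g : G, LinearMap.trace ℂ E (σ g ∘ₗ A) * LinearMap.trace ℂ W (ρ g⁻¹)
      = Fintype.card G * μ := by
  have hG : (Fintype.card G : ℂ) ≠ 0 := by simp
  have : Invertible (Nat.card G : ℂ) := invertibleOfNonzero (by simp)
  have hdim := Representation.card_inv_mul_sum_char_mul_char_eq_finrank ρ σ
  rw [← (Representation.invariantsEquivIntertwiningMap ρ σ).finrank_eq] at hdim
  simp only [Representation.character, Nat.card_eq_fintype_card] at hdim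
  have hLi : ∀ g, Representation.linHom ρ σ g i = i := by
    intro g
    rw [Representation.linHom_apply, ← LinearMap.comp_assoc, hint, LinearMap.comp_assoc,
      ← Module.End.mul_eq_comp, ← map_mul]
    simp
    rfl
  let i' : (Representation.linHom ρ σ).invariants := ⟨i, hLi⟩
  have hi' : i' ≠ 0 := by
    intro h
    exact hi (congrArg Subtype.val h)
  have h1 : finrank ℂ (Representation.linHom ρ σ).invariants = 1 := by
    rcases hm with hm | hm
    · rw [hm, mul_zero] at hdim
      have h0 : finrank ℂ (Representation.linHom ρ σ).invariants = 0 := by exact_mod_cast hdim.symm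
      have := finrank_zero_iff.1 h0
      exact absurd (Subsingleton.elim _ _) hi'
    · rw [hm, inv_mul_cancel₀ hG] at hdim
      exact_mod_cast hdim.symm
  obtain ⟨l, hl⟩ : ∃ l : (W →ₗ[ℂ] E) →ₗ[ℂ] ℂ, l i = 1 := by
    have hne : ∃ l : Module.Dual ℂ (W →ₗ[ℂ] E), l i ≠ 0 := by
      by_contra! hcon
      exact hi ((Module.forall_dual_apply_eq_zero_iff ℂ i).1 hcon)
    obtain ⟨l, hl⟩ := hne
    exact ⟨(l i)⁻¹ • l, by simp [hl]⟩
  let T : G → ((W →ₗ[ℂ] E) →ₗ[ℂ] (W →ₗ[ℂ] E)) := fun g =>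
    Representation.linHom ρ σ g ∘ₗ A.compRight ℂ
  let Q := ∑ g, T g
  have hQ : ∀ f h, Representation.linHom ρ σ h (Q f) = Q f := by
    intro f h
    simp only [Q, T, LinearMap.sum_apply, map_sum, LinearMap.comp_apply]
    refine Fintype.sum_equiv (Equiv.mulLeft h) _ _ fun g => ?_
    simp [map_mul]
  have hQi : Q i = (Fintype.card G * μ) • i := by
    simp only [Q, T, LinearMap.sum_apply, LinearMap.comp_apply, LinearMap.compRight_apply, hμ,
      map_smul, hLi, Finset.sum_const, Finset.card_univ]
    rw [mul_smul, Nat.cast_smul_eq_nsmul]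
  have hQ2 : Q = (l ∘ₗ Q).smulRight i := by
    ext1 f
    obtain ⟨c, hc⟩ := (finrank_eq_one_iff_of_nonzero' i' hi').1 h1 ⟨Q f, hQ f⟩
    have hc : c • i = Q f := congrArg Subtype.val hc
    simp only [LinearMap.smulRight_apply, LinearMap.comp_apply, ← hc, map_smul, hl, smul_eq_mul,
      mul_one]
  have htr := congrArg (LinearMap.trace ℂ _) hQ2
  rw [LinearMap.trace_smulRight, LinearMap.comp_apply, hQi, map_smul, hl, smul_eq_mul,
    mul_one] at htr
  rw [← htr]
  simp only [Q, map_sum]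
  refine Finset.sum_congr rfl fun g _ => ?_
  rw [aux_trace_comp (σ g ∘ₗ A) (ρ g⁻¹) (T g)]
  intro f
  simp [T, Representation.linHom_apply, LinearMap.comp_assoc]

/-- the permutation representation -/
noncomputable def auxPerm (G V : Type*) [Fintype V] [Group G] [MulAction G V] :
    Representation ℂ G (EuclideanSpace ℂ V) where
  toFun g := (LinearIsometryEquiv.piLpCongrLeft 2 ℂ ℂ
    (MulAction.toPerm g : Equiv.Perm V)).toLinearEquiv.toLinearMap
  map_one' := by
    ext x v
    simp [LinearIsometryEquiv.piLpCongrLeft_apply]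
  map_mul' g h := by
    ext x v
    simp [LinearIsometryEquiv.piLpCongrLeft_apply, mul_smul]

theorem auxPerm_apply {G V : Type*} [Fintype V] [Group G] [MulAction G V] (g : G)
    (x : EuclideanSpace ℂ V) (v : V) : auxPerm G V g x v = x (g⁻¹ • v) := by
  rfl

theorem auxPerm_inner {G V : Type*} [Fintype V] [Group G] [MulAction G V] (g : G)
    (x y : EuclideanSpace ℂ V) : inner ℂ (auxPerm G V g x) (auxPerm G V g y) = inner ℂ x y :=
  LinearIsometryEquiv.inner_map_map _ x y

theorem auxPerm_inner_inv {G V : Type*} [Fintype V] [Group G] [MulAction G V] (g : G)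
    (x y : EuclideanSpace ℂ V) : inner ℂ x (auxPerm G V g⁻¹ y) = inner ℂ (auxPerm G V g x) y := by
  rw [← auxPerm_inner g x, ← Module.End.mul_apply, ← map_mul]
  simp

theorem aux_trace_eucl {V : Type*} [Fintype V] [DecidableEq V]
    (T : EuclideanSpace ℂ V →ₗ[ℂ] EuclideanSpace ℂ V) :
    LinearMap.trace ℂ _ T = ∑ v, T (EuclideanSpace.single v 1) v := by
  rw [LinearMap.trace_eq_sum_inner T (EuclideanSpace.basisFun V ℂ)]
  simp [EuclideanSpace.inner_single_left]

theorem aux_irred {G V : Type*} [Fintype V] [Group G] [MulAction G V]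
    (E : Submodule ℂ (EuclideanSpace ℂ V)) (hE : E ≠ ⊥)
    (hinv : ∀ (g : G), ∀ w ∈ E, auxPerm G V g w ∈ E) :
    ∃ (n : ℕ) (ρ : Representation ℂ G (Fin n → ℂ)) (i : (Fin n → ℂ) →ₗ[ℂ] EuclideanSpace ℂ V),
      IsIrredRep ρ ∧ i ≠ 0 ∧ (∀ g, auxPerm G V g ∘ₗ i = i ∘ₗ ρ g) ∧ (∀ x, i x ∈ E) ∧
      ∀ g, LinearMap.trace ℂ _ (ρ g⁻¹) = starRingEnd ℂ (LinearMap.trace ℂ _ (ρ g)) := by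
  classical
  let P : Set (Submodule ℂ (EuclideanSpace ℂ V)) :=
    {S | S ≠ ⊥ ∧ S ≤ E ∧ ∀ (g : G), ∀ w ∈ S, auxPerm G V g w ∈ S}
  obtain ⟨S, ⟨hS0, hSE, hSi⟩, hmin⟩ := WellFounded.has_min
    (wellFounded_lt (α := Submodule ℂ (EuclideanSpace ℂ V))) P ⟨E, hE, le_rfl, hinv⟩
  let b := stdOrthonormalBasis ℂ S
  let e : S ≃ₗ[ℂ] (Fin (Module.finrank ℂ S) → ℂ) := b.toBasis.equivFun
  let r : Representation ℂ G S :=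
    { toFun := fun g => (auxPerm G V g).restrict (hSi g)
      map_one' := by ext; simp
      map_mul' := by intro g h; ext; simp }
  have hr : ∀ g (x : S), (r g x : EuclideanSpace ℂ V) = auxPerm G V g x := fun g x => rfl
  let ρ : Representation ℂ G (Fin (Module.finrank ℂ S) → ℂ) :=
    { toFun := fun g => e.conj (r g)
      map_one' := by rw [map_one]; ext; simp
      map_mul' := by intro g h; rw [map_mul]; ext; simp }
  have hρ : ∀ g, ρ g = e.conj (r g) := fun g => rfl
  have hρ' : ∀ g x, ρ g x = e (r g (e.symm x)) := fun g x => rfl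
  let i : (Fin (Module.finrank ℂ S) → ℂ) →ₗ[ℂ] EuclideanSpace ℂ V :=
    S.subtype ∘ₗ e.symm.toLinearMap
  have hi : ∀ x, i x = (e.symm x : EuclideanSpace ℂ V) := fun x => rfl
  have hinj : Function.Injective i := Subtype.val_injective.comp e.symm.injective
  have hint : ∀ g, auxPerm G V g ∘ₗ i = i ∘ₗ ρ g := by
    intro g
    refine LinearMap.ext fun x => ?_
    simp [hi, hρ', hr]
  have hnt : Nontrivial S := Submodule.nontrivial_iff_ne_bot.2 hS0
  have hnt' : Nontrivial (Fin (Module.finrank ℂ S) → ℂ) := e.symm.toEquiv.nontrivial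
  refine ⟨_, ρ, i, ⟨hnt', fun p hp => ?_⟩, ?_, hint, fun x => hSE (e.symm x).2, ?_⟩
  · by_cases hp0 : p = ⊥
    · exact Or.inl hp0
    right
    have hle : p.map i ≤ S := by
      rintro _ ⟨x, -, rfl⟩
      exact (e.symm x).2
    have hPm : p.map i ∈ P := by
      refine ⟨?_, hle.trans hSE, ?_⟩
      · intro h
        apply hp0
        exact Submodule.map_injective_of_injective hinj (by rw [h, Submodule.map_bot])
      · rintro g _ ⟨x, hx, rfl⟩
        exact ⟨ρ g x, hp g x hx, (LinearMap.congr_fun (hint g) x).symm⟩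
    have heq : p.map i = S := by
      by_contra hne
      exact hmin _ hPm (lt_of_le_of_ne hle hne)
    rw [eq_top_iff]
    intro x _
    have hx : i x ∈ p.map i := by rw [heq]; exact (e.symm x).2
    obtain ⟨y, hy, hyx⟩ := hx
    exact hinj hyx ▸ hy
  · intro h
    obtain ⟨x, hx⟩ := exists_ne (0 : Fin (Module.finrank ℂ S) → ℂ)
    exact hx (hinj (by simp [h]))
  · intro g
    rw [hρ, hρ, LinearMap.trace_conj', LinearMap.trace_conj', LinearMap.trace_eq_sum_inner _ b,
      LinearMap.trace_eq_sum_inner _ b, map_sum]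
    refine Finset.sum_congr rfl fun j _ => ?_
    rw [inner_conj_symm, Submodule.coe_inner, Submodule.coe_inner, hr, hr, auxPerm_inner_inv]

open scoped Classical in
/-- Let `G` be a group acting by automorphisms on a finite simple graph `Γ`, transitively
on the vertices, and let `τ(g) = tr(g ∘ α)` be the number of vertices `v` adjacent to
`v^g`.  Then (a) `τ` is a class function on `G`, and (b) if the permutation character
`ψ` (counting fixed vertices) is multiplicity-free — i.e. `⟨ψ, χ⟩ ∈ {0, 1}` for every
irreducible complex character `χ` of `G` (characters realised as traces of irreducible
representations) — then every eigenvalue of the adjacency matrix of `Γ` equals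
`⟨τ, χ⟩ = |G|⁻¹ Σ_g τ(g) · conj(χ(g))` for some irreducible character `χ`. -/
theorem stmt19 {V : Type*} [Fintype V] [DecidableEq V] (Γ : SimpleGraph V)
    {G : Type*} [Group G] [Fintype G] [MulAction G V]
    (hact : ∀ (g : G) (v w : V), Γ.Adj v w ↔ Γ.Adj (g • v) (g • w))
    (htrans : ∀ u v : V, ∃ g : G, g • u = v)
    (τ ψ : G → ℂ)
    (hτ : ∀ g : G, τ g = ((Finset.univ.filter fun v : V => Γ.Adj v (g • v)).card : ℂ))
    (hψ : ∀ g : G, ψ g = ((Finset.univ.filter fun v : V => g • v = v).card : ℂ)) :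
    (∀ g h : G, τ (h⁻¹ * g * h) = τ g) ∧
    ((∀ (W : Type) (_ : AddCommGroup W) (_ : Module ℂ W)
        (_ : FiniteDimensional ℂ W) (ρ : Representation ℂ G W), IsIrredRep ρ →
        (∑ g : G, ψ g * (starRingEnd ℂ) (LinearMap.trace ℂ W (ρ g))) = 0 ∨
        (∑ g : G, ψ g * (starRingEnd ℂ) (LinearMap.trace ℂ W (ρ g))) =
          (Fintype.card G : ℂ)) →
      ∀ μ : ℂ, (∃ x : V → ℂ, x ≠ 0 ∧ (Γ.adjMatrix ℂ).mulVec x = μ • x) →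
        ∃ (W : Type) (_ : AddCommGroup W) (_ : Module ℂ W)
          (_ : FiniteDimensional ℂ W) (ρ : Representation ℂ G W), IsIrredRep ρ ∧
          μ = (Fintype.card G : ℂ)⁻¹ *
            ∑ g : G, τ g * (starRingEnd ℂ) (LinearMap.trace ℂ W (ρ g))) := by
  have hact' : ∀ (g : G) (v w : V), Γ.Adj (g⁻¹ • v) w ↔ Γ.Adj v (g • w) := by
    intro g v w
    rw [hact g, smul_inv_smul]
  constructor
  · intro g h
    rw [hτ, hτ]
    congr 1
    refine Finset.card_equiv (MulAction.toPerm h) fun v => ?_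
    simp only [Finset.mem_filter, Finset.mem_univ, true_and, MulAction.toPerm_apply]
    rw [hact h]
    simp [mul_smul]
  intro hmf μ ⟨x, hx0, hx⟩
  let A : EuclideanSpace ℂ V →ₗ[ℂ] EuclideanSpace ℂ V := Matrix.toLpLin 2 2 (Γ.adjMatrix ℂ)
  have hAap : ∀ (y : EuclideanSpace ℂ V) v, A y v = ∑ w, if Γ.Adj v w then y w else 0 := by
    intro y v
    simp [A, Matrix.mulVec, dotProduct, SimpleGraph.adjMatrix_apply]
  have hA : ∀ g, auxPerm G V g ∘ₗ A = A ∘ₗ auxPerm G V g := by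
    intro g
    ext1 y
    ext v
    simp only [LinearMap.comp_apply, auxPerm_apply, hAap]
    refine Fintype.sum_equiv (MulAction.toPerm g) _ _ fun w => ?_
    simp [hact']
  have hτ' : ∀ g, τ g = LinearMap.trace ℂ _ (auxPerm G V g ∘ₗ A) := by
    intro g
    rw [hτ, aux_trace_eucl]
    rw [Finset.card_filter, Nat.cast_sum]
    refine Finset.sum_congr rfl fun v _ => ?_
    simp only [LinearMap.comp_apply, auxPerm_apply, hAap, hact']
    rw [Finset.sum_eq_single v]
    · simp
    · intro w _ hw
      simp [hw]
    · simp
  have hψ' : ∀ g, ψ g = LinearMap.trace ℂ _ (auxPerm G V g) := by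
    intro g
    rw [hψ, aux_trace_eucl]
    rw [Finset.card_filter, Nat.cast_sum]
    refine Finset.sum_congr rfl fun v _ => ?_
    have : g • v = v ↔ g⁻¹ • v = v := by rw [inv_smul_eq_iff, eq_comm]
    simp [auxPerm_apply, this]
  obtain ⟨n, ρ, i, hirr, hi0, hint, hiE, hconj⟩ := aux_irred (G := G)
    (Module.End.eigenspace A μ) (by
      intro h
      have : WithLp.toLp 2 x ∈ Module.End.eigenspace A μ := by
        rw [Module.End.mem_eigenspace_iff]
        ext v
        simpa [A] using congrFun hx v
      rw [h, Submodule.mem_bot] at this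
      exact hx0 (by simpa using this)) (by
      intro g w hw
      rw [Module.End.mem_eigenspace_iff] at hw ⊢
      have := LinearMap.congr_fun (hA g) w
      simp only [LinearMap.comp_apply] at this
      rw [← this, hw, map_smul])
  refine ⟨Fin n → ℂ, inferInstance, inferInstance, inferInstance, ρ, hirr, ?_⟩
  have hm := hmf (Fin n → ℂ) inferInstance inferInstance inferInstance ρ hirr
  simp only [← hconj, hψ'] at hm
  have := aux_main (auxPerm G V) ρ A hA i hi0 hint μ (by
    refine LinearMap.ext fun y => ?_
    exact Module.End.mem_eigenspace_iff.1 (hiE y)) hm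
  simp only [← hconj, hτ', this]
  rw [inv_mul_cancel_left₀]
  simp
end
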